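/- arXiv:1901.10028 — 7 statements merged into one kernel-verified Lean document; each statement's English description precedes it below -/
import Mathlib

section
/- Let μ be a probability measure on ℝ with μ({λ : λ ≤ 0}) = 0 and ∫ λ dμ(λ) < ∞. Then for every ρ > 0 and β > 0 there exists a unique ξ > 0 satisfying the fixed-point equation ξ = ∫ λ(1+ξ)/(ρ(1+ξ) + βλ) dμ(λ). -/
open MeasureTheory

/-- The kernel `l / (ρ (1 + x) + β l)` is dominated by `l / ρ` for `x, l ≥ 0`. -/
theorem resolvent_kernel_le {ρ β x l : ℝ} (hρ : 0 < ρ) (hβ : 0 < β) (hx : 0 ≤ x) (hl : 0 ≤ l) :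
    l / (ρ * (1 + x) + β * l) ≤ l / ρ := by
  gcongr
  nlinarith [mul_nonneg hρ.le hx, mul_nonneg hβ.le hl]

theorem integrable_resolvent_kernel {μ : Measure ℝ} (hpos : ∀ᵐ l ∂μ, 0 < l)
    (hint : Integrable (fun l : ℝ => l) μ) {ρ β x : ℝ} (hρ : 0 < ρ) (hβ : 0 < β) (hx : 0 ≤ x) :
    Integrable (fun l : ℝ => l / (ρ * (1 + x) + β * l)) μ := by
  refine (hint.div_const ρ).mono' (Measurable.aestronglyMeasurable (by fun_prop)) ?_
  filter_upwards [hpos] with l hl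
  rw [Real.norm_of_nonneg (by positivity)]
  exact resolvent_kernel_le hρ hβ hx hl.le

theorem continuousOn_integral_resolvent_kernel {μ : Measure ℝ} (hpos : ∀ᵐ l ∂μ, 0 < l)
    (hint : Integrable (fun l : ℝ => l) μ) {ρ β : ℝ} (hρ : 0 < ρ) (hβ : 0 < β) :
    ContinuousOn (fun x : ℝ => ∫ l, l / (ρ * (1 + x) + β * l) ∂μ) (Set.Ici 0) := by
  refine continuousOn_of_dominated (bound := fun l => l / ρ) 
    (fun x _ => Measurable.aestronglyMeasurable (by fun_prop)) ?_
    (hint.div_const ρ) ?_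
  · intro x (hx : 0 ≤ x)
    filter_upwards [hpos] with l hl
    rw [Real.norm_of_nonneg (by positivity)]
    exact resolvent_kernel_le hρ hβ hx hl.le
  · filter_upwards [hpos] with l hl x (hx : 0 ≤ x)
    have : ρ * (1 + x) + β * l ≠ 0 := by positivity
    exact ContinuousAt.continuousWithinAt (by fun_prop (disch := assumption))

theorem antitoneOn_integral_resolvent_kernel {μ : Measure ℝ} (hpos : ∀ᵐ l ∂μ, 0 < l)
    (hint : Integrable (fun l : ℝ => l) μ) {ρ β : ℝ} (hρ : 0 < ρ) (hβ : 0 < β) :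
    AntitoneOn (fun x : ℝ => ∫ l, l / (ρ * (1 + x) + β * l) ∂μ) (Set.Ici 0) := by
  intro x (hx : 0 ≤ x) y (hy : 0 ≤ y) hxy
  refine integral_mono_ae (integrable_resolvent_kernel hpos hint hρ hβ hy)
    (integrable_resolvent_kernel hpos hint hρ hβ hx) ?_
  filter_upwards [hpos] with l hl
  gcongr

theorem integral_resolvent_kernel_pos {μ : Measure ℝ} [NeZero μ] (hpos : ∀ᵐ l ∂μ, 0 < l)
    (hint : Integrable (fun l : ℝ => l) μ) {ρ β x : ℝ} (hρ : 0 < ρ) (hβ : 0 < β) (hx : 0 ≤ x) :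
    0 < ∫ l, l / (ρ * (1 + x) + β * l) ∂μ := by
  have hker : ∀ᵐ l ∂μ, 0 < l / (ρ * (1 + x) + β * l) := by
    filter_upwards [hpos] with l hl
    positivity
  have hnonneg := hker.mono fun l hl => hl.le
  refine (integral_nonneg_of_ae hnonneg).lt_of_ne' fun h => ?_
  rw [integral_eq_zero_iff_of_nonneg_ae hnonneg
    (integrable_resolvent_kernel hpos hint hρ hβ hx)] at h
  obtain ⟨l, hl, hl'⟩ := (hker.and h).exists
  exact hl.ne' hl'

theorem one_add_mul_integral_resolvent_kernel_le {μ : Measure ℝ} (hpos : ∀ᵐ l ∂μ, 0 < l)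
    (hint : Integrable (fun l : ℝ => l) μ) {ρ β x : ℝ} (hρ : 0 < ρ) (hβ : 0 < β) (hx : 0 ≤ x) :
    (1 + x) * ∫ l, l / (ρ * (1 + x) + β * l) ∂μ ≤ ∫ l, l / ρ ∂μ := by
  rw [← integral_const_mul]
  refine integral_mono_ae ((integrable_resolvent_kernel hpos hint hρ hβ hx).const_mul _)
    (hint.div_const ρ) ?_
  filter_upwards [hpos] with l hl
  rw [← mul_div_assoc, div_le_div_iff₀ (by positivity) hρ]
  nlinarith [mul_pos hβ (mul_pos hl hl)]

/-- Let `μ` be a probability measure on `ℝ` supported on the positive reals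
(`μ {λ | λ ≤ 0} = 0`) with finite first moment. Then for every `ρ > 0` and `β > 0`
there exists a unique `ξ > 0` satisfying the fixed-point equation
`ξ = ∫ λ(1+ξ)/(ρ(1+ξ) + βλ) dμ(λ)`. -/
theorem exists_unique_fixed_point_xi (μ : Measure ℝ) [IsProbabilityMeasure μ]
    (hpos : μ {l : ℝ | l ≤ 0} = 0) (hint : Integrable (fun l : ℝ => l) μ)
    (ρ β : ℝ) (hρ : 0 < ρ) (hβ : 0 < β) :
    ∃! ξ : ℝ, 0 < ξ ∧ ξ = ∫ l, l * (1 + ξ) / (ρ * (1 + ξ) + β * l) ∂μ := by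
  have hpos' : ∀ᵐ l ∂μ, 0 < l := by
    simpa [ae_iff] using hpos
  set H : ℝ → ℝ := fun x => ∫ l, l / (ρ * (1 + x) + β * l) ∂μ with hH
  have hF (x : ℝ) : ∫ l, l * (1 + x) / (ρ * (1 + x) + β * l) ∂μ = (1 + x) * H x := by
    rw [hH, ← integral_const_mul]
    congr with l
    ring
  simp only [hF]
  have hM : 0 ≤ ∫ l, l / ρ ∂μ :=
    integral_nonneg_of_ae (hpos'.mono fun l hl => by dsimp; positivity)
  refine existsUnique_of_exists_of_unique ?_ ?_
  · have hcont : ContinuousOn (fun x => (1 + x) * H x - x) (Set.Icc 0 (∫ l, l / ρ ∂μ)) :=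
      ((by fun_prop : Continuous fun x : ℝ => 1 + x).continuousOn.mul
        ((continuousOn_integral_resolvent_kernel hpos' hint hρ hβ).mono
          Set.Icc_subset_Ici_self)).sub continuousOn_id
    have h0 : 0 < H 0 := integral_resolvent_kernel_pos hpos' hint hρ hβ le_rfl
    obtain ⟨x, hx, hx'⟩ := intermediate_value_Icc' hM hcont
      ⟨sub_nonpos.2 (one_add_mul_integral_resolvent_kernel_le hpos' hint hρ hβ hM),
        by simpa using h0.le⟩
    refine ⟨x, hx.1.lt_of_ne' ?_, (sub_eq_zero.1 hx').symm⟩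
    rintro rfl
    simp [h0.ne'] at hx'
  · have key {x y : ℝ} (hx : 0 < x) (hy : 0 < y) (hxH : x = (1 + x) * H x)
        (hyH : y = (1 + y) * H y) : y ≤ x := by
      by_contra! hxy
      have hanti : H y ≤ H x :=
        antitoneOn_integral_resolvent_kernel hpos' hint hρ hβ hx.le hy.le hxy.le
      -- Both fixed points satisfy `H z = z / (1 + z)`, which is strictly increasing in `z`.
      nlinarith [mul_le_mul_of_nonneg_left hanti (by positivity : 0 ≤ (1 + x) * (1 + y))]
    rintro x y ⟨hx, hxH⟩ ⟨hy, hyH⟩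
    exact le_antisymm (key hy hx hyH hxH) (key hx hy hxH hyH)
end

section
/- Fix β ∈ (0,1], γ₀ > 0, ρ_DA ∈ (0,1) and ρ_AD ∈ [0,1). For ρ > 0 let ξ(ρ) = ξ_UC(β,ρ) and define γ_UC(ρ) = ( (1−ρ_AD)(1−ρ_DA)·ξ(ρ)·[1 + (ρ/β)(1+ξ(ρ))²]·γ₀ ) / ( ρ_AD(1−ρ_DA)·ξ(ρ)·[1 + (ρ/β)(1+ξ(ρ))²]·γ₀ + ρ_DA(1+ξ(ρ))²γ₀ + (1−ρ_DA)γ₀ + (1+ξ(ρ))² ). Then for every ρ > 0, γ_UC(ρ) ≤ γ_UC(ρ*), where ρ* = (ρ_DA γ₀ + 1)β / ((1−ρ_DA)γ₀); i.e., ρ* is a global maximizer of γ_UC over (0,∞). -/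
/-- The asymptotic parameter `ξ_UC(β,ρ)` of an RZF-precoded massive MIMO system
under an uncorrelated channel. -/
noncomputable def xiUC (β ρ : ℝ) : ℝ :=
  (Real.sqrt ((1 - β) ^ 2 / ρ ^ 2 + 2 * (1 + β) / ρ + 1) + (1 - β) / ρ - 1) / 2

/-- The asymptotic per-user SIQNR `γ_UC(ρ)` of an RZF-precoded massive MIMO downlink
under an uncorrelated channel, as a function of the normalized regularization
parameter `ρ`. -/
noncomputable def gammaUC (β γ₀ ρDA ρAD ρ : ℝ) : ℝ :=
  (1 - ρAD) * (1 - ρDA) * xiUC β ρ * (1 + ρ / β * (1 + xiUC β ρ) ^ 2) * γ₀ /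
    (ρAD * (1 - ρDA) * xiUC β ρ * (1 + ρ / β * (1 + xiUC β ρ) ^ 2) * γ₀ +
      ρDA * (1 + xiUC β ρ) ^ 2 * γ₀ + (1 - ρDA) * γ₀ + (1 + xiUC β ρ) ^ 2)

theorem xiUC_pos_and_fixedPoint {β ρ : ℝ} (hρ : 0 < ρ) :
    0 < xiUC β ρ ∧ xiUC β ρ * (ρ * (1 + xiUC β ρ) + β) = 1 + xiUC β ρ := by
  have hD : (1 - β) ^ 2 / ρ ^ 2 + 2 * (1 + β) / ρ + 1 = ((1 - β) / ρ - 1) ^ 2 + 4 / ρ := by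
    field_simp
    ring
  have h4 : 0 < 4 / ρ := by positivity
  have hx : xiUC β ρ =
      (√(((1 - β) / ρ - 1) ^ 2 + 4 / ρ) + (1 - β) / ρ - 1) / 2 := by
    rw [xiUC, hD]
  have hs := Real.sq_sqrt (show 0 ≤ ((1 - β) / ρ - 1) ^ 2 + 4 / ρ by positivity)
  have habs : |(1 - β) / ρ - 1| < √(((1 - β) / ρ - 1) ^ 2 + 4 / ρ) := by
    rw [← Real.sqrt_sq_eq_abs]
    exact Real.sqrt_lt_sqrt (sq_nonneg _) (by linarith)
  refine ⟨by rw [hx]; linarith [neg_abs_le ((1 - β) / ρ - 1)], ?_⟩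
  have hquad : xiUC β ρ ^ 2 = ((1 - β) / ρ - 1) * xiUC β ρ + 1 / ρ := by
    rw [hx]
    linear_combination hs / 4
  field_simp at hquad
  linear_combination hquad

/-- The signal factor, with the regularization parameter eliminated by the fixed-point equation. -/
theorem xiUC_mul_one_add {β ρ : ℝ} (hβ : 0 < β) (hρ : 0 < ρ) :
    xiUC β ρ * (1 + ρ / β * (1 + xiUC β ρ) ^ 2) = (1 + xiUC β ρ) ^ 2 / β - xiUC β ρ ^ 2 := by
  have h := (xiUC_pos_and_fixedPoint (β := β) hρ).2
  field_simp
  linear_combination (1 + xiUC β ρ) * h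

theorem signal_le_xiUC_mul {β c ρ : ℝ} (hβ : 0 < β) (hc : 0 < c) (hρ : 0 < ρ) :
    xiUC β ρ * (1 + ρ / β * (1 + xiUC β ρ) ^ 2) ≤
      xiUC β (c * β) * (1 + c * (1 + xiUC β ρ) ^ 2) := by
  rw [xiUC_mul_one_add hβ hρ]
  obtain ⟨hz, hfix⟩ := xiUC_pos_and_fixedPoint (β := β) (mul_pos hc hβ)
  generalize xiUC β (c * β) = z at hz hfix ⊢
  generalize xiUC β ρ = x
  have hzc : z * c = 1 / β - z / (1 + z) := by
    field_simp
    linear_combination hfix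
  have hdiff : z * (1 + c * (1 + x) ^ 2) - ((1 + x) ^ 2 / β - x ^ 2) = (x - z) ^ 2 / (1 + z) := by
    have : z * (1 + c * (1 + x) ^ 2) = z + (1 / β - z / (1 + z)) * (1 + x) ^ 2 := by
      rw [← hzc]
      ring
    rw [this]
    field_simp
    ring
  have : 0 ≤ (x - z) ^ 2 / (1 + z) := by positivity
  linarith

/-- The regularization parameter `ρ* = (ρ_DA γ₀ + 1)β/((1−ρ_DA)γ₀)` is a global
maximizer of `γ_UC` over `(0,∞)`. -/
theorem gammaUC_le_gammaUC_rhoStar (β γ₀ ρDA ρAD : ℝ)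
    (hβ : 0 < β) (hβ1 : β ≤ 1) (hγ₀ : 0 < γ₀)
    (hDA : ρDA ∈ Set.Ioo (0 : ℝ) 1) (hAD : ρAD ∈ Set.Ico (0 : ℝ) 1) :
    ∀ ρ > (0 : ℝ), gammaUC β γ₀ ρDA ρAD ρ ≤
      gammaUC β γ₀ ρDA ρAD ((ρDA * γ₀ + 1) * β / ((1 - ρDA) * γ₀)) := by
  intro ρ hρ
  obtain ⟨hd0, hd1⟩ := hDA
  obtain ⟨ha0, ha1⟩ := hAD
  have hK : 0 < (1 - ρDA) * γ₀ := mul_pos (by linarith) hγ₀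
  obtain ⟨c, hc⟩ : ∃ c, c = (ρDA * γ₀ + 1) / ((1 - ρDA) * γ₀) := ⟨_, rfl⟩
  have hc0 : 0 < c := by rw [hc]; positivity
  have hcK : ρDA * γ₀ + 1 = c * ((1 - ρDA) * γ₀) := by rw [hc, div_mul_cancel₀ _ hK.ne']
  have hstar : (ρDA * γ₀ + 1) * β / ((1 - ρDA) * γ₀) = c * β := by rw [hc]; ring
  have hform (r : ℝ) : gammaUC β γ₀ ρDA ρAD r =
      (1 - ρAD) * (xiUC β r * (1 + r / β * (1 + xiUC β r) ^ 2)) /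
        (ρAD * (xiUC β r * (1 + r / β * (1 + xiUC β r) ^ 2)) +
          (1 + c * (1 + xiUC β r) ^ 2)) := by
    rw [gammaUC, ← mul_div_mul_left _ (ρAD * _ + _) hK.ne']
    congr 1
    · ring
    · linear_combination (1 + xiUC β r) ^ 2 * hcK
  have hle := signal_le_xiUC_mul hβ hc0 hρ
  have hx := (xiUC_pos_and_fixedPoint (β := β) hρ).1
  have hz := (xiUC_pos_and_fixedPoint (β := β) (mul_pos hc0 hβ)).1
  rw [hstar, hform, hform, mul_div_cancel_right₀ c hβ.ne']
  have hA : 0 < xiUC β ρ * (1 + ρ / β * (1 + xiUC β ρ) ^ 2) := by positivity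
  have hY : 0 < 1 + c * (1 + xiUC β ρ) ^ 2 := by positivity
  have hY' : 0 < 1 + c * (1 + xiUC β (c * β)) ^ 2 := by positivity
  generalize xiUC β ρ * (1 + ρ / β * (1 + xiUC β ρ) ^ 2) = A at *
  generalize 1 + c * (1 + xiUC β ρ) ^ 2 = Y at *
  generalize 1 + c * (1 + xiUC β (c * β)) ^ 2 = Y' at *
  rw [div_le_div_iff₀ (by positivity) (by positivity)]
  have := mul_le_mul_of_nonneg_left hle (mul_nonneg (sub_nonneg.2 ha1.le) hY'.le)
  linear_combination this
end

section
/- Let β > 0, γ₀ > 0, ρ_DA ∈ [0,1), ρ_AD ∈ [0,1), ξ > 0, E₁₂ > 0 and E₂₂ ≥ 0 be real numbers, and set ρ* = (ρ_DA γ₀ + 1)β / ((1−ρ_DA)γ₀). Then the quantity γ = ( (1−ρ_AD)(1−ρ_DA)·ξ·[E₂₂ + (ρ*/β)(1+ξ)²E₁₂]·γ₀ ) / ( ρ_AD(1−ρ_DA)·ξ·[E₂₂ + (ρ*/β)(1+ξ)²E₁₂]·γ₀ + ρ_DA(1+ξ)²E₁₂γ₀ + (1−ρ_DA)E₂₂γ₀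 + (1+ξ)²E₁₂ ) satisfies γ = (1−ρ_AD)·ξ / (1 + ρ_AD·ξ). -/
/-- Substituting the optimal regularization parameter
`ρ* = (ρ_DA γ₀ + 1)β/((1−ρ_DA)γ₀)` into the general asymptotic SIQNR expression
yields `γ* = (1−ρ_AD)ξ/(1+ρ_AD ξ)`. -/
theorem gamma_at_rhoStar (β γ₀ ρDA ρAD ξ E12 E22 : ℝ)
    (hβ : 0 < β) (hγ₀ : 0 < γ₀)
    (hDA : ρDA ∈ Set.Ico (0 : ℝ) 1) (hAD : ρAD ∈ Set.Ico (0 : ℝ) 1)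
    (hξ : 0 < ξ) (hE12 : 0 < E12) (hE22 : 0 ≤ E22) :
    let ρStar := (ρDA * γ₀ + 1) * β / ((1 - ρDA) * γ₀)
    (1 - ρAD) * (1 - ρDA) * ξ * (E22 + ρStar / β * (1 + ξ) ^ 2 * E12) * γ₀ /
        (ρAD * (1 - ρDA) * ξ * (E22 + ρStar / β * (1 + ξ) ^ 2 * E12) * γ₀ +
          ρDA * (1 + ξ) ^ 2 * E12 * γ₀ + (1 - ρDA) * E22 * γ₀ + (1 + ξ) ^ 2 * E12) =
      (1 - ρAD) * ξ / (1 + ρAD * ξ) := by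
  intro ρStar
  have hDA' : 0 < 1 - ρDA := sub_pos.mpr hDA.2
  have hDA₀ : 0 ≤ ρDA := hDA.1
  set D := (1 - ρDA) * E22 * γ₀ + (ρDA * γ₀ + 1) * (1 + ξ) ^ 2 * E12 with hD
  have hDpos : 0 < D := by positivity
  have key : (1 - ρDA) * (E22 + ρStar / β * (1 + ξ) ^ 2 * E12) * γ₀ = D := by
    simp only [ρStar, hD]
    field_simp
  calc
    _ = (1 - ρAD) * ξ * D / ((1 + ρAD * ξ) * D) := by
      congr 1
      · linear_combination (1 - ρAD) * ξ * key
      · linear_combination ρAD * ξ * key + hD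
    _ = _ := mul_div_mul_right _ _ hDpos.ne'
end

section
/- Let β > 0, γ₀ > 0, ρ > 0, ρ_AD ∈ [0,1), ξ > 0, E₁₂ > 0 and E₂₂ > 0 be fixed real numbers. Then the function ρ_DA ↦ γ(ρ_DA) = ( (1−ρ_AD)(1−ρ_DA)·ξ·[E₂₂ + (ρ/β)(1+ξ)²E₁₂]·γ₀ ) / ( ρ_AD(1−ρ_DA)·ξ·[E₂₂ + (ρ/β)(1+ξ)²E₁₂]·γ₀ + ρ_DA(1+ξ)²E₁₂γ₀ + (1−ρ_DA)E₂₂γ₀ + (1+ξ)²E₁₂ ) is strictly decreasing on [0,1). -/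
/-- The asymptotic SIQNR is strictly decreasing in the DAC distortion factor `ρ_DA`
on `[0,1)`: higher-resolution DACs yield strictly larger asymptotic SIQNR. -/
theorem gamma_strictAntiOn_rhoDA (β γ₀ ρ ρAD ξ E12 E22 : ℝ)
    (hβ : 0 < β) (hγ₀ : 0 < γ₀) (hρ : 0 < ρ) (hAD : ρAD ∈ Set.Ico (0 : ℝ) 1)
    (hξ : 0 < ξ) (hE12 : 0 < E12) (hE22 : 0 < E22) :
    StrictAntiOn (fun ρDA : ℝ =>
      (1 - ρAD) * (1 - ρDA) * ξ * (E22 + ρ / β * (1 + ξ) ^ 2 * E12) * γ₀ /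
        (ρAD * (1 - ρDA) * ξ * (E22 + ρ / β * (1 + ξ) ^ 2 * E12) * γ₀ +
          ρDA * (1 + ξ) ^ 2 * E12 * γ₀ + (1 - ρDA) * E22 * γ₀ + (1 + ξ) ^ 2 * E12))
      (Set.Ico (0 : ℝ) 1) := by
  obtain ⟨hA0, hA1⟩ := hAD
  have hK : 0 < E22 + ρ / β * (1 + ξ) ^ 2 * E12 := by positivity
  generalize E22 + ρ / β * (1 + ξ) ^ 2 * E12 = K at hK ⊢
  have denom_pos : ∀ z ∈ Set.Ico (0 : ℝ) 1,
      0 < ρAD * (1 - z) * ξ * K * γ₀ + z * (1 + ξ) ^ 2 * E12 * γ₀ + (1 - z) * E22 * γ₀ +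
        (1 + ξ) ^ 2 * E12 := by
    rintro z ⟨hz0, hz1⟩
    have : 0 < 1 - z := sub_pos.2 hz1
    positivity
  intro x hx y hy hxy
  dsimp only
  rw [div_lt_div_iff₀ (denom_pos y hy) (denom_pos x hx)]
  have hA : 0 < 1 - ρAD := sub_pos.2 hA1
  have hyx : 0 < y - x := sub_pos.2 hxy
  have hcross : 0 < (1 - ρAD) * ξ * K * γ₀ * (y - x) * ((1 + ξ) ^ 2 * E12 * (γ₀ + 1)) := by
    positivity
  linear_combination hcross
end

section
/- Fix β > 0 and ρ_DA ∈ (0,1). For γ₀ > 0 let ρ*(γ₀) = (ρ_DA γ₀ + 1)β / ((1−ρ_DA)γ₀) and ξ*(γ₀) = ξ_UC(β, ρ*(γ₀)). Then lim_{γ₀→0⁺} ξ*(γ₀)/γ₀ = (1−ρ_DA)/β. -/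
open Filter

/-- As a function of `t = 1/ρ`, the parameter `ξ_UC` has derivative `1` at `t = 0`. -/
theorem hasDerivAt_xiUC_inv (β : ℝ) : HasDerivAt (fun t : ℝ => xiUC β t⁻¹) 1 0 := by
  have hid := hasDerivAt_id (0 : ℝ)
  have hpoly : HasDerivAt (fun t : ℝ => (1 - β) ^ 2 * t ^ 2 + 2 * (1 + β) * t + 1)
      (2 * (1 + β)) 0 := by
    refine ((((hid.pow 2).const_mul ((1 - β) ^ 2)).add
      (hid.const_mul (2 * (1 + β)))).add_const 1).congr_deriv ?_
    simp
  have hsqrt := hpoly.sqrt (by simp)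
  refine ((((hsqrt.add (hid.const_mul (1 - β))).sub_const 1).div_const 2).congr_deriv
    ?_).congr_of_eventuallyEq (.of_forall fun t => ?_)
  · simp
  · simp [xiUC, div_eq_mul_inv]

/-- Low-SNR first-order expansion: with the optimal regularization parameter
`ρ*(γ₀) = (ρ_DA γ₀ + 1)β/((1−ρ_DA)γ₀)`, the parameter `ξ*(γ₀) = ξ_UC(β,ρ*(γ₀))`
satisfies `ξ*(γ₀)/γ₀ → (1−ρ_DA)/β` as `γ₀ → 0⁺`. -/
theorem xiStar_div_gamma0_tendsto (β ρDA : ℝ) (hβ : 0 < β)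
    (hDA : ρDA ∈ Set.Ioo (0 : ℝ) 1) :
    Tendsto (fun γ₀ : ℝ => xiUC β ((ρDA * γ₀ + 1) * β / ((1 - ρDA) * γ₀)) / γ₀)
      (nhdsWithin 0 (Set.Ioi 0)) (nhds ((1 - ρDA) / β)) := by
  have hinv : HasDerivAt (fun γ : ℝ => (1 - ρDA) * γ / ((ρDA * γ + 1) * β))
      ((1 - ρDA) / β) 0 := by
    have hid := hasDerivAt_id (0 : ℝ)
    refine ((hid.const_mul (1 - ρDA)).div (((hid.const_mul ρDA).add_const 1).mul_const β)
      (by simpa using hβ.ne')).congr_deriv ?_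
    simp
    field_simp
  have hcomp := HasDerivAt.comp_of_eq (0 : ℝ) (hasDerivAt_xiUC_inv β) hinv (by simp)
  have hslope := hcomp.tendsto_slope_zero_right
  rw [one_mul] at hslope
  refine hslope.congr fun γ => ?_
  have hzero : xiUC β 0 = 0 := by simp [xiUC]
  simp only [Function.comp_apply, inv_div, zero_add, mul_zero, zero_div, inv_zero, hzero,
    sub_zero, smul_eq_mul]
  rw [inv_mul_eq_div]
end

section
/- Let η > 0 and define β*(c) = −c + √(c² + c/η) for c > 0. Then β* is strictly increasing on (0,∞). Consequently, with c = γ₀(1+ρ_AD)(1−ρ_DA) for γ₀ > 0, ρ_AD ∈ (0,1), ρ_DA ∈ (0,1), the optimal user loading ratio β* is strictly increasing in γ₀, strictly increasing in ρ_AD, and strictly decreasing in ρ_DA. -/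
/-- The closed-form optimal user loading ratio `β*(c) = −c + √(c² + c/η)`. -/
noncomputable def betaStar (η c : ℝ) : ℝ := -c + Real.sqrt (c ^ 2 + c / η)

/-- The square root in `betaStar` lies strictly below its asymptote `c + 1/(2η)`. -/
theorem sqrt_sq_add_div_lt {η c : ℝ} (hη : 0 < η) (hc : 0 < c) :
    Real.sqrt (c ^ 2 + c / η) < c + η⁻¹ / 2 := by
  have hk : 0 < η⁻¹ := inv_pos.mpr hη
  rw [Real.sqrt_lt' (by positivity), div_eq_mul_inv]
  nlinarith [sq_pos_of_pos hk]

theorem betaStar_strictMonoOn {η : ℝ} (hη : 0 < η) :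
    StrictMonoOn (betaStar η) (Set.Ioi 0) := by
  intro a (ha : 0 < a) b _ hab
  have hs := sqrt_sq_add_div_lt hη ha
  have hsq : Real.sqrt (a ^ 2 + a / η) ^ 2 = a ^ 2 + a * η⁻¹ := by
    rw [Real.sq_sqrt (by positivity), div_eq_mul_inv]
  have hlt : Real.sqrt (a ^ 2 + a / η) + (b - a) < Real.sqrt (b ^ 2 + b / η) := by
    apply Real.lt_sqrt_of_sq_lt
    rw [div_eq_mul_inv b]
    nlinarith [mul_lt_mul_of_pos_left hs (sub_pos.mpr hab)]
  unfold betaStar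
  linarith

/-- For `η > 0`, `β*` is strictly increasing on `(0,∞)`. Consequently, with
`c = γ₀(1+ρ_AD)(1−ρ_DA)`, the optimal user loading ratio is strictly increasing in
the SNR `γ₀`, strictly increasing in the ADC distortion `ρ_AD`, and strictly
decreasing in the DAC distortion `ρ_DA`. -/
theorem betaStar_monotone (η : ℝ) (hη : 0 < η) :
    StrictMonoOn (betaStar η) (Set.Ioi 0) ∧
    (∀ ρAD ∈ Set.Ioo (0 : ℝ) 1, ∀ ρDA ∈ Set.Ioo (0 : ℝ) 1,
      StrictMonoOn (fun γ₀ : ℝ => betaStar η (γ₀ * (1 + ρAD) * (1 - ρDA)))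
        (Set.Ioi 0)) ∧
    (∀ γ₀ : ℝ, 0 < γ₀ → ∀ ρDA ∈ Set.Ioo (0 : ℝ) 1,
      StrictMonoOn (fun ρAD : ℝ => betaStar η (γ₀ * (1 + ρAD) * (1 - ρDA)))
        (Set.Ioo 0 1)) ∧
    (∀ γ₀ : ℝ, 0 < γ₀ → ∀ ρAD ∈ Set.Ioo (0 : ℝ) 1,
      StrictAntiOn (fun ρDA : ℝ => betaStar η (γ₀ * (1 + ρAD) * (1 - ρDA)))
        (Set.Ioo 0 1)) := by
  have hmono := betaStar_strictMonoOn hη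
  refine ⟨hmono, ?_, ?_, ?_⟩
  · rintro ρAD ⟨hAD, -⟩ ρDA ⟨-, hDA⟩
    have hDA' : 0 < 1 - ρDA := sub_pos.mpr hDA
    refine hmono.comp (fun x _ y _ hxy => ?_) (fun x (hx : 0 < x) => ?_)
    · gcongr
    · exact Set.mem_Ioi.mpr (by positivity)
  · rintro γ₀ hγ ρDA ⟨-, hDA⟩
    have hDA' : 0 < 1 - ρDA := sub_pos.mpr hDA
    refine hmono.comp (fun x _ y _ hxy => ?_) (fun x hx => ?_)
    · gcongr
    · have := hx.1
      exact Set.mem_Ioi.mpr (by positivity)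
  · rintro γ₀ hγ ρAD ⟨hAD, -⟩
    refine hmono.comp_strictAntiOn (fun x _ y _ hxy => ?_) (fun x hx => ?_)
    · gcongr
    · have : 0 < 1 - x := sub_pos.mpr hx.2
      exact Set.mem_Ioi.mpr (by positivity)
end

section
/- Fix β > 0 and let ξ(ρ) = ξ_UC(β,ρ) = (1/2)·( √((1−β)²/ρ² + 2(1+β)/ρ + 1) + (1−β)/ρ − 1 ) for ρ > 0. Then ξ is differentiable on (0,∞) and for every ρ > 0 its derivative equals −ξ(ρ)²(1+ξ(ρ))² / ( (1+ξ(ρ))² − β·ξ(ρ)² ); moreover (1+ξ(ρ))² − β·ξ(ρ)² > 0, so in particular ξ is strictly decreasing in ρ. -/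
theorem xiUC_pos {β ρ : ℝ} (hρ : 0 < ρ) : 0 < xiUC β ρ := by
  have h : |(1 - β) / ρ - 1| <
      Real.sqrt ((1 - β) ^ 2 / ρ ^ 2 + 2 * (1 + β) / ρ + 1) := by
    rw [← Real.sqrt_sq_eq_abs]
    apply Real.sqrt_lt_sqrt (sq_nonneg _)
    have h4 : 0 < 4 / ρ := by positivity
    have hD : (1 - β) ^ 2 / ρ ^ 2 + 2 * (1 + β) / ρ + 1 =
        ((1 - β) / ρ - 1) ^ 2 + 4 / ρ := by
      field_simp
      ring
    linarith
  have h' := neg_abs_le ((1 - β) / ρ - 1)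
  unfold xiUC
  linarith

theorem sqrt_eq_xiUC (β ρ : ℝ) :
    Real.sqrt ((1 - β) ^ 2 / ρ ^ 2 + 2 * (1 + β) / ρ + 1) =
      2 * xiUC β ρ + 1 - (1 - β) / ρ := by
  unfold xiUC
  ring

theorem xiUC_fixed_point {β ρ : ℝ} (hβ : 0 < β) (hρ : 0 < ρ) :
    xiUC β ρ * (ρ * (1 + xiUC β ρ) + β) = 1 + xiUC β ρ := by
  have hD : 0 ≤ (1 - β) ^ 2 / ρ ^ 2 + 2 * (1 + β) / ρ + 1 := by positivity
  have hS := Real.sq_sqrt hD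
  rw [sqrt_eq_xiUC] at hS
  field_simp at hS
  have hmul : ρ * (xiUC β ρ * (ρ * (1 + xiUC β ρ) + β)) = ρ * (1 + xiUC β ρ) := by
    linear_combination hS / 4
  exact mul_left_cancel₀ hρ.ne' hmul

/-- The denominator of the derivative of `ξ_UC` in terms of the square root defining `ξ_UC`. -/
theorem xiUC_denominator_eq {β ρ : ℝ} (hβ : 0 < β) (hρ : 0 < ρ) :
    (1 + xiUC β ρ) ^ 2 - β * xiUC β ρ ^ 2 =
      ρ * Real.sqrt ((1 - β) ^ 2 / ρ ^ 2 + 2 * (1 + β) / ρ + 1) *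
        (xiUC β ρ * (1 + xiUC β ρ)) := by
  have h := xiUC_fixed_point hβ hρ
  rw [sqrt_eq_xiUC]
  field_simp
  linear_combination (-(2 * xiUC β ρ + 1)) * h

theorem xiUC_denominator_pos {β ρ : ℝ} (hβ : 0 < β) (hρ : 0 < ρ) :
    0 < (1 + xiUC β ρ) ^ 2 - β * xiUC β ρ ^ 2 := by
  have hξ := xiUC_pos (β := β) hρ
  rw [xiUC_denominator_eq hβ hρ]
  positivity

theorem xiUC_hasDerivAt {β ρ : ℝ} (hβ : 0 < β) (hρ : 0 < ρ) :
    HasDerivAt (fun r : ℝ => xiUC β r)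
      (-(xiUC β ρ) ^ 2 * (1 + xiUC β ρ) ^ 2 /
        ((1 + xiUC β ρ) ^ 2 - β * (xiUC β ρ) ^ 2)) ρ := by
  have hξ := xiUC_pos (β := β) hρ
  have hρ0 := hρ.ne'
  have hD : 0 < (1 - β) ^ 2 / ρ ^ 2 + 2 * (1 + β) / ρ + 1 := by positivity
  have hS := Real.sqrt_pos.2 hD
  have hdiv (c : ℝ) : HasDerivAt (fun r : ℝ => c / r) (-c / ρ ^ 2) ρ := by
    refine HasDerivAt.congr_deriv (f := fun r : ℝ => c / r)
      ((hasDerivAt_const ρ c).div (hasDerivAt_id ρ) hρ0) ?_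
    simp
  have hdiv_sq : HasDerivAt (fun r : ℝ => (1 - β) ^ 2 / r ^ 2)
      (-2 * (1 - β) ^ 2 / ρ ^ 3) ρ := by
    refine HasDerivAt.congr_deriv (f := fun r : ℝ => (1 - β) ^ 2 / r ^ 2)
      ((hasDerivAt_const ρ ((1 - β) ^ 2)).div (hasDerivAt_pow 2 ρ) (pow_ne_zero 2 hρ0)) ?_
    field_simp
    norm_num
    ring
  have hderiv := ((((((hdiv_sq.add (hdiv (2 * (1 + β)))).add_const 1).sqrt hD.ne').add
    (hdiv (1 - β))).sub_const 1).div_const 2)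
  refine HasDerivAt.congr_deriv (f := fun r : ℝ => xiUC β r) hderiv ?_
  have hfix := xiUC_fixed_point hβ hρ
  have hsqrt := sqrt_eq_xiUC β ρ
  simp only [Pi.add_apply]
  rw [xiUC_denominator_eq hβ hρ]
  generalize xiUC β ρ = ξ at *
  generalize Real.sqrt ((1 - β) ^ 2 / ρ ^ 2 + 2 * (1 + β) / ρ + 1) = S at *
  field_simp
  field_simp at hsqrt
  linear_combination (-(1 - β)) * hsqrt + 2 * ρ * hfix

/-- For fixed `β > 0`, the map `ρ ↦ ξ_UC(β,ρ)` has derivative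
`−ξ²(1+ξ)²/((1+ξ)² − βξ²)` at every `ρ > 0`, where moreover `(1+ξ)² − βξ² > 0`;
in particular it is strictly decreasing on `(0,∞)`. -/
theorem xiUC_hasDerivAt_and_strictAnti (β : ℝ) (hβ : 0 < β) :
    (∀ ρ : ℝ, 0 < ρ →
      HasDerivAt (fun r : ℝ => xiUC β r)
        (-(xiUC β ρ) ^ 2 * (1 + xiUC β ρ) ^ 2 /
          ((1 + xiUC β ρ) ^ 2 - β * (xiUC β ρ) ^ 2)) ρ ∧
      0 < (1 + xiUC β ρ) ^ 2 - β * (xiUC β ρ) ^ 2) ∧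
    StrictAntiOn (fun ρ : ℝ => xiUC β ρ) (Set.Ioi 0) := by
  refine ⟨fun ρ hρ => ⟨xiUC_hasDerivAt hβ hρ, xiUC_denominator_pos hβ hρ⟩, ?_⟩
  refine strictAntiOn_of_deriv_neg (convex_Ioi 0)
    (fun ρ hρ => (xiUC_hasDerivAt hβ hρ).continuousAt.continuousWithinAt) fun ρ hρ => ?_
  rw [interior_Ioi] at hρ
  have hξ := xiUC_pos (β := β) hρ
  rw [(xiUC_hasDerivAt hβ hρ).deriv]
  refine div_neg_of_neg_of_pos ?_ (xiUC_denominator_pos hβ hρ)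
  rw [neg_mul]
  exact neg_neg_of_pos (by positivity)
end
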